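/- The entropic optimal transport problem inf{ KL(π|K) : π ∈ Π(μ̂,ν̂) } admits a unique minimizer π* ∈ Π(μ̂,ν̂). -/

import Mathlib

open MeasureTheory ENNReal Filter Topology

noncomputable section

/-- `phi s = s * log s - s + 1` (note `phi 0 = 1` since `Real.log 0 = 0`);
this is the integrand of the Kullback--Leibler divergence. -/
def phi (s : ℝ) : ℝ := s * Real.log s - s + 1

open Classical in
/-- Kullback--Leibler divergence `KL(ρ|σ) ∈ [0,∞]`: `∫ phi (dρ/dσ) dσ` if `ρ ≪ σ`,
and `∞` otherwise (nonnegativity of `ρ` is automatic for measures). -/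
def KL {Z : Type*} [MeasurableSpace Z] (ρ σ : Measure Z) : ℝ≥0∞ :=
  if ρ ≪ σ then ∫⁻ z, ENNReal.ofReal (phi ((ρ.rnDeriv σ) z).toReal) ∂σ else ⊤

/-- The set `Π(μh, νh)` of transport plans with marginals `μh` and `νh`. -/
def Coupling {X Y : Type*} [MeasurableSpace X] [MeasurableSpace Y]
    (μh : Measure X) (νh : Measure Y) : Set (Measure (X × Y)) :=
  {π | π.map Prod.fst = μh ∧ π.map Prod.snd = νh}

/-- The Gibbs kernel measure `K = exp(-c/ε) ⋅ (μ ⊗ ν)`. -/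
def Kmeas {X Y : Type*} [MeasurableSpace X] [MeasurableSpace Y]
    (μ : Measure X) (ν : Measure Y) [SFinite ν] (c : X × Y → ℝ) (ε : ℝ) : Measure (X × Y) :=
  (μ.prod ν).withDensity fun p => ENNReal.ofReal (Real.exp (-c p / ε))

/-- The product density `(u ⊗ v)(x,y) = u x * v y`, as an `ℝ≥0∞`-valued density. -/
def prodDensity {X Y : Type*} (u : X → ℝ) (v : Y → ℝ) : X × Y → ℝ≥0∞ :=
  fun p => ENNReal.ofReal (u p.1 * v p.2)

/-- `L^∞₊(μ)`: measurable, a.e. nonnegative, essentially bounded functions. -/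
def LinftyPlus {Z : Type*} [MeasurableSpace Z] (μ : Measure Z) (u : Z → ℝ) : Prop :=
  Measurable u ∧ (∀ᵐ z ∂μ, 0 ≤ u z) ∧ ∃ C : ℝ, ∀ᵐ z ∂μ, u z ≤ C

theorem phi_eq_klFun : phi = InformationTheory.klFun := by
  funext s
  simp only [phi, InformationTheory.klFun]
  ring

theorem continuous_phi : Continuous phi := phi_eq_klFun ▸ InformationTheory.continuous_klFun

theorem measurable_phi : Measurable phi := continuous_phi.measurable

theorem phi_nonneg {s : ℝ} (hs : 0 ≤ s) : 0 ≤ phi s :=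
  phi_eq_klFun ▸ InformationTheory.klFun_nonneg hs

theorem mul_log_sub_mul_log_ge {a m : ℝ} (ha : 0 ≤ a) (hm : 0 < m) :
    2 * a - 2 * (√a * √m) ≤ a * Real.log a - a * Real.log m := by
  rcases ha.eq_or_lt with rfl | ha
  · simp
  have hsa := Real.sqrt_pos.2 ha
  have hsm := Real.sqrt_pos.2 hm
  have h := Real.log_le_sub_one_of_pos (div_pos hsm hsa)
  rw [Real.log_div hsm.ne' hsa.ne', Real.log_sqrt hm.le, Real.log_sqrt ha.le] at h
  have h2 := mul_le_mul_of_nonneg_left h ha.le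
  have h3 : a * (√m / √a - 1) = √a * √m - a := by
    rw [show a * (√m / √a - 1) = a / √a * √m - a by ring, Real.div_sqrt]
  rw [h3] at h2
  nlinarith

/-- A quantitative form of the strict convexity of `phi`. -/
theorem two_mul_phi_midpoint_add_le {a b : ℝ} (ha : 0 ≤ a) (hb : 0 ≤ b) :
    2 * phi ((a + b) / 2) + (√a - √b) ^ 2 / 2 ≤ phi a + phi b := by
  rcases (div_nonneg (add_nonneg ha hb) zero_le_two).eq_or_lt with h | hm
  · obtain rfl : a = 0 := by linarith
    obtain rfl : b = 0 := by linarith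
    norm_num [phi]
  · have h1 := mul_log_sub_mul_log_ge ha hm
    have h2 := mul_log_sub_mul_log_ge hb hm
    have e1 := Real.sq_sqrt ha
    have e2 := Real.sq_sqrt hb
    have e3 := Real.sq_sqrt hm.le
    simp only [phi]
    generalize √a = p at *
    generalize √b = q at *
    generalize √((a + b) / 2) = r at *
    nlinarith [sq_nonneg (r - p - (q - r))]

/-- The square root of the density of `π` with respect to `K`. -/
def sqrtDensity {Z : Type*} [MeasurableSpace Z] (π K : Measure Z) : Z → ℝ :=
  fun z => √((π.rnDeriv K z).toReal)

section KL

variable {Z : Type*} [MeasurableSpace Z]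

theorem measurable_sqrtDensity (π K : Measure Z) : Measurable (sqrtDensity π K) :=
  (Measure.measurable_rnDeriv π K).ennreal_toReal.sqrt

theorem KL_of_ac {ρ σ : Measure Z} (h : ρ ≪ σ) :
    KL ρ σ = ∫⁻ z, ENNReal.ofReal (phi ((ρ.rnDeriv σ) z).toReal) ∂σ := if_pos h

theorem ac_of_KL_ne_top {ρ σ : Measure Z} (h : KL ρ σ ≠ ⊤) : ρ ≪ σ := by
  by_contra hac
  exact h (if_neg hac)

theorem eLpNorm_two_sq (g : Z → ℝ) (K : Measure Z) :
    eLpNorm g 2 K ^ 2 = ∫⁻ z, ENNReal.ofReal (g z ^ 2) ∂K := by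
  have h := eLpNorm_nnreal_pow_eq_lintegral (f := g) (μ := K) (p := 2) two_ne_zero
  simp only [NNReal.coe_ofNat, ENNReal.coe_ofNat, ENNReal.rpow_two] at h
  refine h.trans (lintegral_congr fun z => ?_)
  rw [← enorm_pow, Real.enorm_of_nonneg (sq_nonneg _)]

theorem eLpNorm_sqrtDensity_sq (π K : Measure Z) [IsFiniteMeasure π] [SigmaFinite K]
    (h : π ≪ K) (A : Set Z) :
    eLpNorm (sqrtDensity π K) 2 (K.restrict A) ^ 2 = π A := by
  rw [eLpNorm_two_sq, ← Measure.setLIntegral_rnDeriv h]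
  refine lintegral_congr_ae (ae_restrict_of_ae ?_)
  filter_upwards [π.rnDeriv_lt_top K] with z hz
  rw [sqrtDensity, Real.sq_sqrt ENNReal.toReal_nonneg, ENNReal.ofReal_toReal hz.ne]

theorem memLp_sqrtDensity (π K : Measure Z) [IsFiniteMeasure π] [SigmaFinite K] (h : π ≪ K) :
    MemLp (sqrtDensity π K) 2 K := by
  refine ⟨(measurable_sqrtDensity π K).aestronglyMeasurable, ?_⟩
  have := eLpNorm_sqrtDensity_sq π K h Set.univ
  rw [Measure.restrict_univ] at this
  refine lt_top_iff_ne_top.2 fun htop => ?_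
  rw [htop, ENNReal.top_pow two_ne_zero] at this
  exact measure_ne_top π _ this.symm

theorem rnDeriv_midpoint (π π' K : Measure Z) [IsFiniteMeasure π] [IsFiniteMeasure π']
    [SigmaFinite K] :
    ((2⁻¹ : ℝ≥0∞) • (π + π')).rnDeriv K =ᵐ[K]
      fun z => 2⁻¹ * (π.rnDeriv K z + π'.rnDeriv K z) := by
  filter_upwards [Measure.rnDeriv_smul_left_of_ne_top (π + π') K (r := 2⁻¹) (by simp),
    Measure.rnDeriv_add π π' K] with z h1 h2
  rw [h1, Pi.smul_apply, h2, Pi.add_apply, smul_eq_mul]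

theorem two_mul_KL_midpoint_add_le (π π' K : Measure Z) [IsFiniteMeasure π] [IsFiniteMeasure π']
    [SigmaFinite K] :
    2 * KL ((2⁻¹ : ℝ≥0∞) • (π + π')) K
      + 2⁻¹ * eLpNorm (sqrtDensity π K - sqrtDensity π' K) 2 K ^ 2 ≤ KL π K + KL π' K := by
  by_cases h : π ≪ K
  swap; · simp [KL, if_neg h]
  by_cases h' : π' ≪ K
  swap; · simp [KL, if_neg h']
  have hm : (2⁻¹ : ℝ≥0∞) • (π + π') ≪ K := (h.add_left h').smul_left _
  have meas (ρ : Measure Z) :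
      Measurable fun z => ENNReal.ofReal (phi (ρ.rnDeriv K z).toReal) :=
    (measurable_phi.comp (ρ.measurable_rnDeriv K).ennreal_toReal).ennreal_ofReal
  rw [KL_of_ac h, KL_of_ac h', KL_of_ac hm, eLpNorm_two_sq, ← lintegral_const_mul _ (meas _),
    ← lintegral_const_mul' _ _ (by simp), ← lintegral_add_left ((meas _).const_mul _),
    ← lintegral_add_left (meas _)]
  refine lintegral_mono_ae ?_
  filter_upwards [rnDeriv_midpoint π π' K, π.rnDeriv_lt_top K, π'.rnDeriv_lt_top K]
    with z hz h1 h2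
  have hsum : (2⁻¹ * (π.rnDeriv K z + π'.rnDeriv K z)).toReal
      = ((π.rnDeriv K z).toReal + (π'.rnDeriv K z).toReal) / 2 := by
    rw [ENNReal.toReal_mul, ENNReal.toReal_add h1.ne h2.ne]
    simp [div_eq_inv_mul]
  rw [hz, hsum, Pi.sub_apply, sqrtDensity, sqrtDensity]
  have ha := ENNReal.toReal_nonneg (a := π.rnDeriv K z)
  have hb := ENNReal.toReal_nonneg (a := π'.rnDeriv K z)
  generalize (π.rnDeriv K z).toReal = a at *
  generalize (π'.rnDeriv K z).toReal = b at *
  have e2 : (2 : ℝ≥0∞) = ENNReal.ofReal 2 := by simp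
  have e2' : (2⁻¹ : ℝ≥0∞) = ENNReal.ofReal 2⁻¹ := by
    rw [ENNReal.ofReal_inv_of_pos two_pos]; simp
  have hp := phi_nonneg (div_nonneg (add_nonneg ha hb) zero_le_two)
  rw [← ENNReal.ofReal_add (phi_nonneg ha) (phi_nonneg hb), e2', e2,
    ← ENNReal.ofReal_mul (by positivity), ← ENNReal.ofReal_mul (by positivity),
    ← ENNReal.ofReal_add (by positivity) (by positivity)]
  refine ENNReal.ofReal_le_ofReal (le_trans (le_of_eq ?_) (two_mul_phi_midpoint_add_le ha hb))
  ring

theorem eq_of_eLpNorm_sqrtDensity_sub_eq_zero {π π' K : Measure Z} [IsFiniteMeasure π]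
    [IsFiniteMeasure π'] [SigmaFinite K] (h : π ≪ K) (h' : π' ≪ K)
    (h0 : eLpNorm (sqrtDensity π K - sqrtDensity π' K) 2 K = 0) : π = π' := by
  have hae := (eLpNorm_eq_zero_iff ((measurable_sqrtDensity π K).sub
    (measurable_sqrtDensity π' K)).aestronglyMeasurable two_ne_zero).1 h0
  ext A -
  rw [← eLpNorm_sqrtDensity_sq π K h A, ← eLpNorm_sqrtDensity_sq π' K h' A]
  congr 1
  refine eLpNorm_congr_ae (ae_restrict_of_ae ?_)
  filter_upwards [hae] with z hz
  exact sub_eq_zero.1 hz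

theorem inv_two_smul_add_self (ρ : Measure Z) : (2⁻¹ : ℝ≥0∞) • (ρ + ρ) = ρ := by
  rw [smul_add, ← add_smul, ENNReal.inv_two_add_inv_two, one_smul]

theorem tendsto_eLpNorm_of_tendsto_eLpNorm_sub {K : Measure Z} {g : ℕ → Z → ℝ} {f : Z → ℝ}
    (hg : ∀ n, MemLp (g n) 2 K) (hf : MemLp f 2 K)
    (h : Tendsto (fun n => eLpNorm (g n - f) 2 K) atTop (𝓝 0)) :
    Tendsto (fun n => eLpNorm (g n) 2 K) atTop (𝓝 (eLpNorm f 2 K)) := by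
  have := ((Lp.tendsto_Lp_iff_tendsto_eLpNorm'' g hg f hf).2 h).norm
  simp only [Lp.norm_toLp] at this
  exact (ENNReal.tendsto_toReal_iff (fun n => (hg n).eLpNorm_ne_top) hf.eLpNorm_ne_top).1 this

/-- If the square roots of the densities of a sequence of measures converge in `L²`, then the
measures converge setwise. -/
theorem tendsto_measure_of_tendsto_sqrtDensity {K : Measure Z} [SigmaFinite K]
    {u : ℕ → Measure Z} [∀ n, IsFiniteMeasure (u n)] (hac : ∀ n, u n ≪ K) {f : Z → ℝ}
    (hf : MemLp f 2 K)
    (h : Tendsto (fun n => eLpNorm (sqrtDensity (u n) K - f) 2 K) atTop (𝓝 0))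
    {A : Set Z} (hA : MeasurableSet A) :
    Tendsto (fun n => u n A) atTop
      (𝓝 (K.withDensity (fun z => ENNReal.ofReal (f z ^ 2)) A)) := by
  have hA0 : Tendsto (fun n => eLpNorm (sqrtDensity (u n) K - f) 2 (K.restrict A))
      atTop (𝓝 0) :=
    tendsto_of_tendsto_of_tendsto_of_le_of_le tendsto_const_nhds h (fun _ => zero_le)
      fun n => eLpNorm_mono_measure _ Measure.restrict_le_self
  have hlim := tendsto_eLpNorm_of_tendsto_eLpNorm_sub
    (fun n => (memLp_sqrtDensity (u n) K (hac n)).restrict A) (hf.restrict A) hA0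
  rw [withDensity_apply _ hA, ← eLpNorm_two_sq]
  simp_rw [← fun n => eLpNorm_sqrtDensity_sq (u n) K (hac n) A]
  exact ENNReal.Tendsto.pow hlim

theorem KL_withDensity_sq_le_liminf {K : Measure Z} [SigmaFinite K] {u : ℕ → Measure Z}
    (hac : ∀ n, u n ≪ K) {f : Z → ℝ} (hf : AEMeasurable f K)
    (h : ∀ᵐ z ∂K, Tendsto (fun n => sqrtDensity (u n) K z) atTop (𝓝 (f z))) :
    KL (K.withDensity fun z => ENNReal.ofReal (f z ^ 2)) K
      ≤ liminf (fun n => KL (u n) K) atTop := by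
  rw [KL_of_ac (withDensity_absolutelyContinuous _ _)]
  simp_rw [fun n => KL_of_ac (hac n)]
  refine le_trans (lintegral_mono_ae ?_) (lintegral_liminf_le fun n =>
    (measurable_phi.comp ((u n).measurable_rnDeriv K).ennreal_toReal).ennreal_ofReal)
  filter_upwards [h, Measure.rnDeriv_withDensity₀ K (hf.pow_const 2).ennreal_ofReal]
    with z hz hd
  rw [hd, ENNReal.toReal_ofReal (sq_nonneg _)]
  have hsq := hz.pow 2
  simp only [sqrtDensity, Real.sq_sqrt ENNReal.toReal_nonneg] at hsq
  exact (ENNReal.tendsto_ofReal ((continuous_phi.tendsto _).comp hsq)).liminf_eq.ge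

/-- A set of finite measures which is stable under midpoints and setwise limits, and on which
`KL · K` is not identically infinite, contains a unique minimizer of `KL · K`. -/
theorem existsUnique_minimizer_KL (K : Measure Z) [SigmaFinite K] (S : Set (Measure Z))
    (hfin : ∀ π ∈ S, IsFiniteMeasure π)
    (hmid : ∀ π ∈ S, ∀ π' ∈ S, (2⁻¹ : ℝ≥0∞) • (π + π') ∈ S)
    (hclosed : ∀ (u : ℕ → Measure Z) (π : Measure Z), (∀ n, u n ∈ S) →
      (∀ A, MeasurableSet A → Tendsto (fun n => u n A) atTop (𝓝 (π A))) → π ∈ S)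
    (hex : ∃ π ∈ S, KL π K ≠ ⊤) :
    ∃! π, π ∈ S ∧ ∀ π' ∈ S, KL π K ≤ KL π' K := by
  obtain ⟨π₀, hπ₀, hπ₀top⟩ := hex
  set I : ℝ≥0∞ := ⨅ π ∈ S, KL π K
  have hI : ∀ π ∈ S, I ≤ KL π K := fun π hπ => iInf₂_le π hπ
  have hItop : I ≠ ⊤ := ne_top_of_le_ne_top hπ₀top (hI π₀ hπ₀)
  have hgap : ∀ π ∈ S, ∀ π' ∈ S,
      2 * I + 2⁻¹ * eLpNorm (sqrtDensity π K - sqrtDensity π' K) 2 K ^ 2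
        ≤ KL π K + KL π' K := fun π hπ π' hπ' => by
    have := hfin π hπ
    have := hfin π' hπ'
    refine le_trans ?_ (two_mul_KL_midpoint_add_le π π' K)
    gcongr
    exact hI _ (hmid π hπ π' hπ')
  let B : ℕ → ℝ≥0∞ := fun n => 2⁻¹ ^ n
  have hBpos (n : ℕ) : B n ≠ 0 := pow_ne_zero _ (by simp)
  have hBanti : Antitone B := fun m n h => pow_le_pow_of_le_one zero_le (by simp) h
  have hex_u (n : ℕ) : ∃ π ∈ S, KL π K < I + 4⁻¹ * B n ^ 2 := by
    have : I < I + 4⁻¹ * B n ^ 2 :=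
      ENNReal.lt_add_right hItop (mul_ne_zero (by simp) (pow_ne_zero _ (hBpos n)))
    simpa only [I, iInf_lt_iff, exists_prop] using this
  choose u huS hu using hex_u
  have hufin (n : ℕ) : IsFiniteMeasure (u n) := hfin _ (huS n)
  have huac (n : ℕ) : u n ≪ K := ac_of_KL_ne_top (hu n).ne_top
  have hcau (N n m : ℕ) (hn : N ≤ n) (hm : N ≤ m) :
      eLpNorm (sqrtDensity (u n) K - sqrtDensity (u m) K) 2 K < B N := by
    have hlt (k : ℕ) (hk : N ≤ k) : KL (u k) K < I + 4⁻¹ * B N ^ 2 := by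
      refine (hu k).trans_le ?_
      gcongr
      exact hBanti hk
    have h := (hgap _ (huS n) _ (huS m)).trans_lt (ENNReal.add_lt_add (hlt n hn) (hlt m hm))
    have h4 : (4⁻¹ : ℝ≥0∞) + 4⁻¹ = 2⁻¹ := by
      rw [← ENNReal.toReal_eq_toReal_iff' (by simp) (by simp),
        ENNReal.toReal_add (by simp) (by simp)]
      norm_num
    rw [show I + 4⁻¹ * B N ^ 2 + (I + 4⁻¹ * B N ^ 2) = 2 * I + (4⁻¹ + 4⁻¹) * B N ^ 2 by ring,
      h4] at h
    have h' := lt_of_add_lt_add_left h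
    exact lt_of_not_ge fun hge => h'.not_ge (by gcongr)
  have hBsum : ∑' n, B n ≠ ⊤ := by
    simp [B, ENNReal.tsum_geometric]
  obtain ⟨f, hf, hlim⟩ := Lp.cauchy_complete_eLpNorm one_le_two
    (fun n => memLp_sqrtDensity (u n) K (huac n)) hBsum hcau
  obtain ⟨ns, hns, hae⟩ := (tendstoInMeasure_of_tendsto_eLpNorm two_ne_zero
    (fun n => (measurable_sqrtDensity (u n) K).aestronglyMeasurable) hf.1
    hlim).exists_seq_tendsto_ae
  have hKLlim : Tendsto (fun n => KL (u n) K) atTop (𝓝 I) := by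
    have hB0 : Tendsto (fun n => I + 4⁻¹ * B n ^ 2) atTop (𝓝 (I + 4⁻¹ * 0 ^ 2)) :=
      tendsto_const_nhds.add (ENNReal.Tendsto.const_mul (ENNReal.Tendsto.pow
        (ENNReal.tendsto_pow_atTop_nhds_zero_of_lt_one (by simp))) (by simp))
    rw [zero_pow two_ne_zero, mul_zero, add_zero] at hB0
    exact tendsto_of_tendsto_of_tendsto_of_le_of_le tendsto_const_nhds hB0
      (fun n => hI _ (huS n)) fun n => (hu n).le
  have hle := KL_withDensity_sq_le_liminf (fun n => huac (ns n)) hf.1.aemeasurable hae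
  replace hle := hle.trans (hKLlim.comp hns.tendsto_atTop).liminf_eq.le
  have hπS := hclosed u _ huS fun A hA =>
    tendsto_measure_of_tendsto_sqrtDensity huac hf hlim hA
  refine ⟨_, ⟨hπS, fun π' hπ' => hle.trans (hI π' hπ')⟩, fun π' hπ' => ?_⟩
  have hle' := (hπ'.2 _ hπS).trans hle
  have := hfin _ hπS
  have := hfin _ hπ'.1
  refine eq_of_eLpNorm_sqrtDensity_sub_eq_zero (ac_of_KL_ne_top (ne_top_of_le_ne_top hItop hle'))
    (withDensity_absolutelyContinuous _ _) ?_
  have h := (hgap _ hπ'.1 _ hπS).trans (add_le_add hle' hle)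
  rw [← two_mul] at h
  have h0 := ENNReal.le_of_add_le_add_left (c := 0) (ENNReal.mul_ne_top (by simp) hItop)
    (h.trans (add_zero _).ge)
  simpa using h0

theorem KL_ne_top_of_le_smul {ρ K : Measure Z} [IsFiniteMeasure K] {C : ℝ≥0∞} (hC : C ≠ ⊤)
    (h : ρ ≤ C • K) : KL ρ K ≠ ⊤ := by
  have hac : ρ ≪ K := (Measure.absolutelyContinuous_of_le h).trans
    (Measure.smul_absolutelyContinuous)
  have : IsFiniteMeasure (C • K) := Measure.smul_finite K hC
  have : IsFiniteMeasure ρ := isFiniteMeasure_of_le _ h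
  have hd : ρ.rnDeriv K ≤ᵐ[K] fun _ => C := by
    refine ae_le_of_forall_setLIntegral_le_of_sigmaFinite (ρ.measurable_rnDeriv K) fun A hA _ => ?_
    rw [setLIntegral_const]
    exact (Measure.setLIntegral_rnDeriv_le A).trans (h A)
  obtain ⟨M, hM⟩ := (isCompact_Icc (a := (0 : ℝ)) (b := C.toReal)).bddAbove_image
    continuous_phi.continuousOn
  rw [KL_of_ac hac]
  refine ne_top_of_le_ne_top (b := ∫⁻ _, ENNReal.ofReal M ∂K) ?_ (lintegral_mono_ae ?_)
  · rw [lintegral_const]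
    exact ENNReal.mul_ne_top (by simp) (measure_ne_top _ _)
  · filter_upwards [hd] with z hz
    exact ENNReal.ofReal_le_ofReal (hM ⟨_, ⟨ENNReal.toReal_nonneg,
      ENNReal.toReal_mono hC hz⟩, rfl⟩)

theorem le_smul_of_rnDeriv_le {ρ μ : Measure Z} [SigmaFinite μ] (hac : ρ ≪ μ) {C : ℝ≥0∞}
    (h : ∀ᵐ z ∂μ, ρ.rnDeriv μ z ≤ C) : ρ ≤ C • μ := by
  have hS : MeasurableSet (ρ.sigmaFiniteSetWRT μ) := measurableSet_sigmaFiniteSetWRT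
  have : SFinite (ρ.restrict (ρ.sigmaFiniteSetWRT μ)ᶜ) := by
    rw [restrict_compl_sigmaFiniteSetWRT hac]
    infer_instance
  have : SFinite ρ := by
    rw [← Measure.restrict_add_restrict_compl (μ := ρ) hS]
    infer_instance
  rw [← Measure.withDensity_rnDeriv_eq ρ μ hac, ← withDensity_const]
  exact withDensity_mono h

end KL

section Coupling

variable {X Y : Type*} [MeasurableSpace X] [MeasurableSpace Y] {μh : Measure X} {νh : Measure Y}

theorem Coupling.isFiniteMeasure [IsFiniteMeasure μh] {π : Measure (X × Y)}
    (hπ : π ∈ Coupling μh νh) : IsFiniteMeasure π := by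
  refine ⟨?_⟩
  rw [← Set.preimage_univ (f := Prod.fst), ← Measure.map_apply measurable_fst .univ, hπ.1]
  exact measure_lt_top _ _

theorem Coupling.midpoint_mem {π π' : Measure (X × Y)} (hπ : π ∈ Coupling μh νh)
    (hπ' : π' ∈ Coupling μh νh) : (2⁻¹ : ℝ≥0∞) • (π + π') ∈ Coupling μh νh := by
  constructor
  · rw [Measure.map_smul, Measure.map_add _ _ measurable_fst, hπ.1, hπ'.1, inv_two_smul_add_self]
  · rw [Measure.map_smul, Measure.map_add _ _ measurable_snd, hπ.2, hπ'.2, inv_two_smul_add_self]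

theorem Coupling.mem_of_tendsto {u : ℕ → Measure (X × Y)} {π : Measure (X × Y)}
    (hu : ∀ n, u n ∈ Coupling μh νh)
    (h : ∀ A, MeasurableSet A → Tendsto (fun n => u n A) atTop (𝓝 (π A))) :
    π ∈ Coupling μh νh := by
  constructor <;> ext A hA
  · rw [Measure.map_apply measurable_fst hA]
    refine tendsto_nhds_unique (h _ (measurable_fst hA)) (tendsto_const_nhds.congr fun n => ?_)
    rw [← Measure.map_apply measurable_fst hA, (hu n).1]
  · rw [Measure.map_apply measurable_snd hA]
    refine tendsto_nhds_unique (h _ (measurable_snd hA)) (tendsto_const_nhds.congr fun n => ?_)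
    rw [← Measure.map_apply measurable_snd hA, (hu n).2]

theorem smul_prod_mem_coupling [IsFiniteMeasure μh] [IsFiniteMeasure νh]
    (hmass : μh Set.univ = νh Set.univ) (hpos : 0 < μh Set.univ) :
    (μh Set.univ)⁻¹ • μh.prod νh ∈ Coupling μh νh := by
  have h1 : (μh Set.univ)⁻¹ * μh Set.univ = 1 :=
    ENNReal.inv_mul_cancel hpos.ne' (measure_ne_top _ _)
  constructor
  · rw [Measure.map_smul, Measure.map_fst_prod, ← hmass, smul_smul, h1, one_smul]
  · rw [Measure.map_smul, Measure.map_snd_prod, smul_smul, h1, one_smul]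

theorem Kmeas.isFiniteMeasure_of_nonneg {μ : Measure X} {ν : Measure Y} [IsFiniteMeasure μ]
    [IsFiniteMeasure ν] {c : X × Y → ℝ} (hc0 : ∀ p, 0 ≤ c p) {ε : ℝ} (hε : 0 < ε) :
    IsFiniteMeasure (Kmeas μ ν c ε) := by
  refine isFiniteMeasure_of_le (μ.prod ν) ?_
  conv_rhs => rw [← withDensity_one (μ := μ.prod ν)]
  refine withDensity_mono (ae_of_all _ fun p => ?_)
  rw [Pi.one_apply, ENNReal.ofReal_le_one, Real.exp_le_one_iff]
  exact div_nonpos_of_nonpos_of_nonneg (neg_nonpos.2 (hc0 p)) hε.le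

theorem prod_le_smul_Kmeas (μ : Measure X) (ν : Measure Y) [SFinite ν] {c : X × Y → ℝ}
    {cmax : ℝ} (hcmax : ∀ p, c p ≤ cmax) {ε : ℝ} (hε : 0 < ε) :
    μ.prod ν ≤ ENNReal.ofReal (Real.exp (cmax / ε)) • Kmeas μ ν c ε := by
  rw [Kmeas, ← withDensity_smul' _ _ (by simp)]
  conv_lhs => rw [← withDensity_one (μ := μ.prod ν)]
  refine withDensity_mono (ae_of_all _ fun p => ?_)
  rw [Pi.one_apply, Pi.smul_apply, smul_eq_mul, ← ENNReal.ofReal_mul (Real.exp_pos _).le,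
    ← Real.exp_add, ENNReal.one_le_ofReal, Real.one_le_exp_iff, ← add_div]
  exact div_nonneg (by linarith [hcmax p]) hε.le

end Coupling

/-- Proposition 2.4 (i): the entropic optimal transport problem
`inf { KL(π|K) : π ∈ Π(μh,νh) }` admits a unique minimizer `π* ∈ Π(μh,νh)`. -/
theorem entropic_ot_unique_minimizer
    {X Y : Type*} [MetricSpace X] [CompactSpace X] [MeasurableSpace X] [BorelSpace X]
    [MetricSpace Y] [CompactSpace Y] [MeasurableSpace Y] [BorelSpace Y]
    (μ : Measure X) (ν : Measure Y) [IsProbabilityMeasure μ] [IsProbabilityMeasure ν]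
    (c : X × Y → ℝ) (hc : Measurable c) (cmax : ℝ)
    (hc0 : ∀ p, 0 ≤ c p) (hcmax : ∀ p, c p ≤ cmax)
    (ε : ℝ) (hε : 0 < ε)
    (μh : Measure X) (νh : Measure Y)
    (hμac : μh ≪ μ) (hνac : νh ≪ ν)
    (hmass : μh Set.univ = νh Set.univ) (hposmass : 0 < μh Set.univ)
    (hμbd : ∃ C : ℝ≥0∞, C ≠ ⊤ ∧ ∀ᵐ x ∂μ, μh.rnDeriv μ x ≤ C)
    (hνbd : ∃ C : ℝ≥0∞, C ≠ ⊤ ∧ ∀ᵐ y ∂ν, νh.rnDeriv ν y ≤ C) :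
    ∃! πopt : Measure (X × Y),
      πopt ∈ Coupling μh νh ∧
        ∀ π ∈ Coupling μh νh, KL πopt (Kmeas μ ν c ε) ≤ KL π (Kmeas μ ν c ε) := by
  obtain ⟨C₁, hC₁, h₁⟩ := hμbd
  obtain ⟨C₂, hC₂, h₂⟩ := hνbd
  have hle₁ : μh ≤ C₁ • μ := le_smul_of_rnDeriv_le hμac h₁
  have hle₂ : νh ≤ C₂ • ν := le_smul_of_rnDeriv_le hνac h₂
  have : IsFiniteMeasure (C₁ • μ) := Measure.smul_finite μ hC₁
  have : IsFiniteMeasure (C₂ • ν) := Measure.smul_finite ν hC₂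
  have : IsFiniteMeasure μh := isFiniteMeasure_of_le _ hle₁
  have : IsFiniteMeasure νh := isFiniteMeasure_of_le _ hle₂
  have : IsFiniteMeasure (Kmeas μ ν c ε) := Kmeas.isFiniteMeasure_of_nonneg hc0 hε
  refine existsUnique_minimizer_KL _ _ (fun _ => Coupling.isFiniteMeasure)
    (fun _ h _ h' => Coupling.midpoint_mem h h') (fun _ _ => Coupling.mem_of_tendsto)
    ⟨_, smul_prod_mem_coupling hmass hposmass, ?_⟩
  refine KL_ne_top_of_le_smul
    (C := (μh Set.univ)⁻¹ * (C₁ * C₂ * ENNReal.ofReal (Real.exp (cmax / ε)))) ?_ ?_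
  · exact ENNReal.mul_ne_top (ENNReal.inv_ne_top.2 hposmass.ne')
      (ENNReal.mul_ne_top (ENNReal.mul_ne_top hC₁ hC₂) ENNReal.ofReal_ne_top)
  · calc (μh Set.univ)⁻¹ • μh.prod νh
        ≤ (μh Set.univ)⁻¹ • (C₁ • μ).prod (C₂ • ν) := by gcongr
      _ = (μh Set.univ)⁻¹ • (C₁ * C₂) • μ.prod ν := by
        rw [Measure.prod_smul_left, Measure.prod_smul_right, smul_smul C₁]
      _ ≤ (μh Set.univ)⁻¹ • (C₁ * C₂) •
          ENNReal.ofReal (Real.exp (cmax / ε)) • Kmeas μ ν c ε := by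
        gcongr
        exact prod_le_smul_Kmeas μ ν hcmax hε
      _ = _ := by simp only [smul_smul]
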